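/- For u, v in the open unit ball of ℝⁿ, the unique positive semidefinite square root of B(u) B(v)² B(u) is the Lorentz boost B(u ⊕ v); equivalently (B(u) B(v)² B(u))^{1/2} = B(u ⊕ v). -/

import Mathlib

open scoped RealInnerProductSpace

noncomputable def gam {n : ℕ} (v : EuclideanSpace ℝ (Fin n)) : ℝ :=
  1 / Real.sqrt (1 - ‖v‖ ^ 2)

noncomputable def eAdd {n : ℕ} (u v : EuclideanSpace ℝ (Fin n)) :
    EuclideanSpace ℝ (Fin n) :=
  (1 / (1 + ⟪u, v⟫)) •
    (u + (1 / gam u) • v + ((gam u / (1 + gam u)) * ⟪u, v⟫) • u)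

noncomputable def boost {n : ℕ} (v : EuclideanSpace ℝ (Fin n)) :
    Matrix (Unit ⊕ Fin n) (Unit ⊕ Fin n) ℝ :=
  Matrix.fromBlocks
    (Matrix.of fun _ _ => gam v)
    (Matrix.of fun _ j => gam v * v j)
    (Matrix.of fun i _ => gam v * v i)
    (1 + Matrix.of fun i j => (gam v) ^ 2 / (1 + gam v) * v i * v j)


open Matrix

noncomputable def bvec {n : ℕ} (a : ℝ) (b : EuclideanSpace ℝ (Fin n)) : Unit ⊕ Fin n → ℝ :=
  Sum.elim (fun _ => a) (fun i => b i)

lemma bvec_surj {n : ℕ} (y : Unit ⊕ Fin n → ℝ) : ∃ a b, y = bvec a b :=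
  ⟨y (Sum.inl ()), WithLp.toLp 2 (fun i => y (Sum.inr i)), by
    ext i; rcases i with i | i <;> simp [bvec]⟩

def bJ (n : ℕ) : Matrix (Unit ⊕ Fin n) (Unit ⊕ Fin n) ℝ :=
  Matrix.fromBlocks 1 0 0 (-1)

lemma ip_sum {n : ℕ} (u b : EuclideanSpace ℝ (Fin n)) : ⟪u, b⟫ = ∑ i, u i * b i := by
  simp [PiLp.inner_apply, mul_comm]

lemma bvec_dot {n : ℕ} (a c : ℝ) (b d : EuclideanSpace ℝ (Fin n)) :
    bvec a b ⬝ᵥ bvec c d = a * c + ⟪b, d⟫ := by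
  simp [bvec, dotProduct, Fintype.sum_sum_type, ip_sum]

lemma bJ_mulVec {n : ℕ} (a : ℝ) (b : EuclideanSpace ℝ (Fin n)) :
    bJ n *ᵥ bvec a b = bvec a (-b) := by
  ext i
  rcases i with i | i <;> simp [bJ, bvec, fromBlocks_mulVec, neg_mulVec, Function.comp_def]

lemma boost_mulVec {n : ℕ} (u : EuclideanSpace ℝ (Fin n)) (a : ℝ) (b : EuclideanSpace ℝ (Fin n)) :
    boost u *ᵥ bvec a b = bvec (gam u * (a + ⟪u, b⟫))
      ((gam u * a + (gam u) ^ 2 / (1 + gam u) * ⟪u, b⟫) • u + b) := by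
  ext i
  rcases i with i | i
  · simp only [boost, bvec, Sum.elim_inl, mulVec, dotProduct, Fintype.sum_sum_type,
      fromBlocks_apply₁₁, fromBlocks_apply₁₂, of_apply, ip_sum, Function.comp_apply, Finset.univ_unique, Finset.sum_singleton, mul_add,
      Finset.mul_sum, mul_assoc, Sum.elim_inr]
  · simp only [boost, bvec, fromBlocks_mulVec, Sum.elim_inr, Sum.elim_inl, Pi.add_apply, add_mulVec,
      one_mulVec, PiLp.add_apply, PiLp.smul_apply, smul_eq_mul, Function.comp_apply]
    simp only [mulVec, dotProduct, of_apply, ip_sum, Function.comp_apply, Finset.univ_unique,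
      Finset.sum_singleton, Sum.elim_inl, Sum.elim_inr]
    have : ∑ x, gam u ^ 2 / (1 + gam u) * u i * u x * b x
        = gam u ^ 2 / (1 + gam u) * u i * ∑ x, u x * b x := by
      rw [Finset.mul_sum]; exact Finset.sum_congr rfl fun _ _ => by ring
    rw [this]; ring

lemma boost_symm {n : ℕ} (u : EuclideanSpace ℝ (Fin n)) : (boost u)ᵀ = boost u := by
  ext i j
  rcases i with i | i <;> rcases j with j | j <;>
    simp [boost, Matrix.one_apply, eq_comm, mul_assoc, mul_comm]

lemma gam_pos {n : ℕ} {u : EuclideanSpace ℝ (Fin n)} (hu : ‖u‖ < 1) : 0 < gam u := by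
  have : 0 < 1 - ‖u‖ ^ 2 := by nlinarith [norm_nonneg u]
  unfold gam; positivity

lemma gam_sq {n : ℕ} {u : EuclideanSpace ℝ (Fin n)} (hu : ‖u‖ < 1) :
    ⟪u, u⟫ = 1 - 1 / gam u ^ 2 := by
  have h : 0 < 1 - ‖u‖ ^ 2 := by nlinarith [norm_nonneg u]
  rw [real_inner_self_eq_norm_sq]
  unfold gam
  rw [div_pow, Real.sq_sqrt h.le]; simp

/-- The norm bound and the gamma factor from a Minkowski normalisation. -/
lemma gam_of {n : ℕ} {w : EuclideanSpace ℝ (Fin n)} {g : ℝ} (hg : 0 < g)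
    (h : ⟪w, w⟫ = 1 - 1 / g ^ 2) : ‖w‖ < 1 ∧ gam w = g := by
  rw [real_inner_self_eq_norm_sq] at h
  have : 0 < 1 / g ^ 2 := by positivity
  refine ⟨by nlinarith [norm_nonneg w], ?_⟩
  unfold gam
  rw [h, sub_sub_cancel, Real.sqrt_div zero_le_one, Real.sqrt_sq hg.le]; simp

lemma boost_sq {n : ℕ} {u : EuclideanSpace ℝ (Fin n)} (hu : ‖u‖ < 1) :
    boost u ^ 2 = (2 : ℝ) • vecMulVec (bvec (gam u) (gam u • u)) (bvec (gam u) (gam u • u))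
      - bJ n := by
  refine Matrix.ext_of_mulVec_single fun i => ?_
  generalize (Pi.single i 1 : Unit ⊕ Fin n → ℝ) = y
  obtain ⟨a, b, rfl⟩ := bvec_surj y
  have hg := gam_pos hu
  have hs := gam_sq hu
  rw [sq, ← mulVec_mulVec, boost_mulVec, boost_mulVec, sub_mulVec, smul_mulVec, bJ_mulVec,
    vecMulVec_mulVec, bvec_dot]
  simp only [inner_add_right, inner_smul_right, inner_smul_left, hs, RCLike.conj_to_real]
  ext j
  rcases j with j | j
  · simp [bvec]
    field_simp
    ring
  · simp [bvec]
    field_simp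
    ring

lemma boost_J {n : ℕ} {u : EuclideanSpace ℝ (Fin n)} (hu : ‖u‖ < 1) :
    boost u * bJ n * boost u = bJ n := by
  refine Matrix.ext_of_mulVec_single fun i => ?_
  generalize (Pi.single i 1 : Unit ⊕ Fin n → ℝ) = y
  obtain ⟨a, b, rfl⟩ := bvec_surj y
  have hg := gam_pos hu
  have hs := gam_sq hu
  rw [← mulVec_mulVec, ← mulVec_mulVec, boost_mulVec, bJ_mulVec, boost_mulVec, bJ_mulVec]
  simp only [inner_add_right, inner_smul_right, inner_smul_left, inner_neg_right, hs]
  ext j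
  rcases j with j | j
  · simp [bvec]
    field_simp
    ring
  · simp [bvec]
    field_simp
    ring

lemma boost_psd {n : ℕ} {u : EuclideanSpace ℝ (Fin n)} (hu : ‖u‖ < 1) :
    (boost u).PosSemidef := by
  refine PosSemidef.of_dotProduct_mulVec_nonneg ?_ fun y => ?_
  · rw [IsHermitian, conjTranspose_eq_transpose_of_trivial, boost_symm]
  obtain ⟨a, b, rfl⟩ := bvec_surj y
  have hg := gam_pos hu
  rw [star_trivial, boost_mulVec, bvec_dot]
  simp only [inner_add_right, inner_smul_right, real_inner_comm u b]
  have hcs : ⟪u, b⟫ ^ 2 ≤ ⟪b, b⟫ := by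
    rw [real_inner_self_eq_norm_sq, ← sq_abs]
    have := abs_real_inner_le_norm u b
    have h2 : ‖u‖ * ‖b‖ ≤ ‖b‖ := by nlinarith [norm_nonneg b]
    exact pow_le_pow_left₀ (abs_nonneg _) (this.trans h2) 2
  have key : 0 ≤ gam u * (a + ⟪u, b⟫) ^ 2 + (⟪b, b⟫ - ⟪u, b⟫ ^ 2)
      + 1 / (1 + gam u) * ⟪u, b⟫ ^ 2 := by
    have := sub_nonneg.2 hcs
    positivity
  refine key.trans_eq ?_
  field_simp
  ring

lemma boost_add {n : ℕ} {u v : EuclideanSpace ℝ (Fin n)} (hu : ‖u‖ < 1) (hv : ‖v‖ < 1) :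
    ‖eAdd u v‖ < 1 ∧ boost u *ᵥ bvec (gam v) (gam v • v)
      = bvec (gam (eAdd u v)) (gam (eAdd u v) • eAdd u v) := by
  have hgu := gam_pos hu
  have hgv := gam_pos hv
  have hsu := gam_sq hu
  have hsv := gam_sq hv
  have h1 : 0 < 1 + ⟪u, v⟫ := by
    have h := (abs_le.1 (abs_real_inner_le_norm u v)).1
    nlinarith [norm_nonneg u, norm_nonneg v]
  obtain ⟨hn, hg⟩ := gam_of (w := eAdd u v) (g := gam u * gam v * (1 + ⟪u, v⟫)) (by positivity) (by
    unfold eAdd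
    simp only [inner_add_right, inner_add_left, inner_smul_right, inner_smul_left, hsu, hsv,
      RCLike.conj_to_real, real_inner_comm u v]
    field_simp
    ring)
  refine ⟨hn, ?_⟩
  rw [hg, boost_mulVec]
  ext j
  rcases j with j | j
  · simp [bvec, inner_smul_right]
    ring
  · simp [bvec, inner_smul_right, eAdd]
    field_simp
    ring

theorem boost_sqrt {n : ℕ} (u v : EuclideanSpace ℝ (Fin n))
    (hu : ‖u‖ < 1) (hv : ‖v‖ < 1)
    (S : Matrix (Unit ⊕ Fin n) (Unit ⊕ Fin n) ℝ) (hS : S.PosSemidef)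
    (hSsq : S ^ 2 = boost u * boost v ^ 2 * boost u) :
    S = boost (eAdd u v) := by 
  obtain ⟨hw, hx⟩ := boost_add hu hv
  have hsq : boost (eAdd u v) ^ 2 = boost u * boost v ^ 2 * boost u := by
    rw [boost_sq hw, boost_sq hv, mul_sub, sub_mul, boost_J hu, mul_smul_comm, smul_mul_assoc,
      mul_vecMulVec, vecMulVec_mul, ← mulVec_transpose, boost_symm, hx]
  open scoped MatrixOrder in
  exact (CFC.mul_self_eq_mul_self_iff S (boost (eAdd u v)) hS.nonneg (boost_psd hw).nonneg).1
    (by rw [← sq, ← sq, hSsq, hsq])
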